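/- Let n ≥ 2 and let A be a unital associative algebra over a commutative unital ring R that is 2-torsion free and (n−1)-torsion free. Suppose that A is commutative, or that A is a noncommutative prime algebra (i.e., A is not commutative, and for all a, b ∈ A, if axb = 0 for every x ∈ A then a = 0 or b = 0). Then every Lie n-derivation on the full matrix algebra M_2(A) of 2×2 matrices over A is standard. -/

import Mathlib

open Finset

/-- Iterated commutator: `pCom x k = p_{k+1}(x 0, ..., x k)`, i.e.
`pCom x 0 = x 0` and `pCom x (k+1) = [pCom x k, x (k+1)]`. -/
def pCom {A : Type*} [Ring A] (x : ℕ → A) : ℕ → A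
  | 0 => x 0
  | k + 1 => pCom x k * x (k + 1) - x (k + 1) * pCom x k

/-- `φ` is a Lie `n`-derivation. -/
def IsLieNDeriv {R : Type*} {A : Type*} [CommRing R] [Ring A] [Algebra R A]
    (n : ℕ) (φ : A →ₗ[R] A) : Prop :=
  ∀ x : ℕ → A,
    φ (pCom x (n - 1)) =
      ∑ i ∈ Finset.range n, pCom (Function.update x i (φ (x i))) (n - 1)

/-- `d` is a derivation. -/
def IsDeriv {R : Type*} {A : Type*} [CommRing R] [Ring A] [Algebra R A]
    (d : A →ₗ[R] A) : Prop :=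
  ∀ x y : A, d (x * y) = d x * y + x * d y

/-- `δ` is a Jordan derivation. -/
def IsJordanDeriv {R : Type*} {A : Type*} [CommRing R] [Ring A] [Algebra R A]
    (δ : A →ₗ[R] A) : Prop :=
  ∀ x y : A, δ (x * y + y * x) = δ x * y + y * δ x + x * δ y + δ y * x

/-- `δ` is an antiderivation. -/
def IsAntiDeriv {R : Type*} {A : Type*} [CommRing R] [Ring A] [Algebra R A]
    (δ : A →ₗ[R] A) : Prop :=
  ∀ x y : A, δ (x * y) = δ y * x + y * δ x

/-- `δ` is a singular Jordan derivation relative to the idempotent `e`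
(with `f = 1 - e`): it is a Jordan derivation killing `eAe` and `fAf`,
mapping `eAf` into `fAe` and `fAe` into `eAf`. -/
def IsSingularJordanDeriv {R : Type*} {A : Type*} [CommRing R] [Ring A] [Algebra R A]
    (e : A) (δ : A →ₗ[R] A) : Prop :=
  IsJordanDeriv δ ∧
  (∀ a : A, δ (e * a * e) = 0) ∧
  (∀ b : A, δ ((1 - e) * b * (1 - e)) = 0) ∧
  (∀ m : A, δ (e * m * (1 - e)) = (1 - e) * δ (e * m * (1 - e)) * e) ∧
  (∀ t : A, δ ((1 - e) * t * e) = e * δ ((1 - e) * t * e) * (1 - e))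

/-- `z` is a central element. -/
def IsCent {A : Type*} [Ring A] (z : A) : Prop := ∀ y : A, z * y = y * z

/-- The centre of `A` as a set. -/
def centerSet (A : Type*) [Ring A] : Set A := {z : A | ∀ y : A, z * y = y * z}

/-- `γ` vanishes on all `(n-1)`-th commutators. -/
def VanishesOnNCommutators {R : Type*} {A : Type*} [CommRing R] [Ring A] [Algebra R A]
    (n : ℕ) (γ : A →ₗ[R] A) : Prop :=
  ∀ x : ℕ → A, γ (pCom x (n - 1)) = 0

/-- A Lie `n`-derivation is standard if it is the sum of a derivation and a
central-valued map vanishing on all `(n-1)`-th commutators. -/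
def IsStandardLieNDeriv {R : Type*} {A : Type*} [CommRing R] [Ring A] [Algebra R A]
    (n : ℕ) (φ : A →ₗ[R] A) : Prop :=
  ∃ d γ : A →ₗ[R] A,
    IsDeriv d ∧ (∀ x : A, IsCent (γ x)) ∧ VanishesOnNCommutators n γ ∧ φ = d + γ

/-- Property (Q) for the idempotent `e` (with `f = 1 - e`):
`exe·eAf = 0 = fAe·exe` implies `exe = 0`, and
`eAf·fxf = 0 = fxf·fAe` implies `fxf = 0`. -/
def PropQ {A : Type*} [Ring A] (e : A) : Prop :=
  (∀ x : A,
    ((∀ y : A, (e * x * e) * (e * y * (1 - e)) = 0) ∧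
     (∀ y : A, ((1 - e) * y * e) * (e * x * e) = 0)) → e * x * e = 0) ∧
  (∀ x : A,
    ((∀ y : A, (e * y * (1 - e)) * ((1 - e) * x * (1 - e)) = 0) ∧
     (∀ y : A, ((1 - e) * x * (1 - e)) * ((1 - e) * y * e) = 0)) →
        (1 - e) * x * (1 - e) = 0)

/-- `A` is `k`-torsion free. -/
def TorsionFreeAt (A : Type*) [Ring A] (k : ℕ) : Prop :=
  ∀ x : A, k • x = 0 → x = 0

/-- The centre of the corner algebra `gAg` (for an idempotent `g`). -/
def cornerCenter {A : Type*} [Ring A] (g : A) : Set A :=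
  {z : A | z = g * z * g ∧ ∀ a : A, z * (g * a * g) = (g * a * g) * z}

/-- The corner algebra `gAg` has no nonzero central ideal: every
ideal of `gAg` consisting of elements central in `gAg` is zero. -/
def NoNonzeroCentralIdeal (R : Type*) [CommRing R] (A : Type*) [Ring A] [Algebra R A]
    (g : A) : Prop :=
  ∀ I : Set A, (0 : A) ∈ I →
    (∀ x ∈ I, x = g * x * g) →
    (∀ x ∈ I, ∀ y ∈ I, x + y ∈ I) →
    (∀ r : R, ∀ x ∈ I, r • x ∈ I) →
    (∀ x ∈ I, ∀ a : A, (g * a * g) * x ∈ I) →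
    (∀ x ∈ I, ∀ a : A, x * (g * a * g) ∈ I) →
    (∀ x ∈ I, ∀ a : A, x * (g * a * g) = (g * a * g) * x) →
    ∀ x ∈ I, x = 0

/-- The generating set of `S(gAg)`: all idempotents of `gAg` together with all
commutators of elements of `gAg`. -/
def cornerGenSet {A : Type*} [Ring A] (g : A) : Set A :=
  {x : A | x = g * x * g ∧ x * x = x} ∪
  {x : A | ∃ a b : A, x = (g * a * g) * (g * b * g) - (g * b * g) * (g * a * g)}

/-- `gAg = S(gAg)`: the corner algebra is generated (as an algebra) by its
idempotents and commutators. -/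
def CornerGenerated (R : Type*) [CommRing R] {A : Type*} [Ring A] [Algebra R A]
    (g : A) : Prop :=
  ∀ x : A, g * x * g ∈ NonUnitalAlgebra.adjoin R (cornerGenSet g)

/-- Condition (*) for the corner algebra `gAg`: if `[x, gAg] ⊆ Z(gAg)` then
`x ∈ Z(gAg)`. -/
def CornerCondStar {A : Type*} [Ring A] (g : A) : Prop :=
  ∀ x : A, x = g * x * g →
    (∀ a : A, x * (g * a * g) - (g * a * g) * x ∈ cornerCenter g) →
    x ∈ cornerCenter g

section LieNDerivations

open Matrix

/-- The sum `∑ᵢ p_{k+1}(x₀, …, φ(xᵢ), …, x_k)`. -/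
def pComLeibniz {A : Type*} [Ring A] (φ : A → A) (x : ℕ → A) (k : ℕ) : A :=
  ∑ i ∈ Finset.range (k + 1), pCom (Function.update x i (φ (x i))) k

lemma pCom_congr {A : Type*} [Ring A] {x y : ℕ → A} {k : ℕ} (h : ∀ i ≤ k, x i = y i) :
    pCom x k = pCom y k := by
  induction k with
  | zero => exact h 0 le_rfl
  | succ k ih =>
    simp only [pCom]
    rw [ih fun i hi => h i (by omega), h (k + 1) le_rfl]

lemma pComLeibniz_zero {A : Type*} [Ring A] (φ : A → A) (x : ℕ → A) :
    pComLeibniz φ x 0 = φ (x 0) := by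
  simp [pComLeibniz, pCom]

lemma pComLeibniz_succ {A : Type*} [Ring A] (φ : A → A) (x : ℕ → A) (k : ℕ) :
    pComLeibniz φ x (k + 1) =
      (pComLeibniz φ x k * x (k + 1) - x (k + 1) * pComLeibniz φ x k) +
        (pCom x k * φ (x (k + 1)) - φ (x (k + 1)) * pCom x k) := by
  unfold pComLeibniz
  rw [Finset.sum_range_succ, Finset.sum_mul, Finset.mul_sum, ← Finset.sum_sub_distrib]
  congr 1
  · refine Finset.sum_congr rfl fun i hi => ?_
    have hi' : k + 1 ≠ i := by
      have := Finset.mem_range.1 hi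
      omega
    simp only [pCom, Function.update_of_ne hi']
  · have h : pCom (Function.update x (k + 1) (φ (x (k + 1)))) k = pCom x k :=
      pCom_congr fun i hi => Function.update_of_ne (by omega) _ _
    simp only [pCom, Function.update_self, h]

lemma isLieNDeriv_succ_iff {R A : Type*} [CommRing R] [Ring A] [Algebra R A] (k : ℕ)
    (φ : A →ₗ[R] A) :
    IsLieNDeriv (k + 1) φ ↔ ∀ x : ℕ → A, φ (pCom x k) = pComLeibniz φ x k :=
  Iff.rfl

lemma IsDeriv.isLieNDeriv {R A : Type*} [CommRing R] [Ring A] [Algebra R A]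
    {d : A →ₗ[R] A} (hd : IsDeriv d) (k : ℕ) : IsLieNDeriv (k + 1) d := by
  rw [isLieNDeriv_succ_iff]
  intro x
  induction k with
  | zero => rw [pComLeibniz_zero]; rfl
  | succ k ih =>
    rw [pComLeibniz_succ, ← ih]
    simp only [pCom, map_sub, hd (pCom x k), hd (x (k + 1))]
    abel

lemma IsLieNDeriv.sub {R A : Type*} [CommRing R] [Ring A] [Algebra R A] {k : ℕ}
    {φ ψ : A →ₗ[R] A} (hφ : IsLieNDeriv (k + 1) φ) (hψ : IsLieNDeriv (k + 1) ψ) :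
    IsLieNDeriv (k + 1) (φ - ψ) := by
  rw [isLieNDeriv_succ_iff] at *
  intro x
  rw [LinearMap.sub_apply, hφ x, hψ x]
  clear hφ hψ
  induction k with
  | zero => simp [pComLeibniz_zero]
  | succ k ih =>
    simp only [pComLeibniz_succ, ← ih, LinearMap.sub_apply]
    noncomm_ring

/-- A Lie derivation is a Lie triple derivation. -/
lemma IsLieNDeriv.three_of_two {R A : Type*} [CommRing R] [Ring A] [Algebra R A]
    {φ : A →ₗ[R] A} (hφ : IsLieNDeriv 2 φ) : IsLieNDeriv 3 φ := by
  rw [isLieNDeriv_succ_iff] at *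
  intro x
  have h := hφ fun i => if i = 0 then pCom x 1 else x 2
  rw [pComLeibniz_succ, pComLeibniz_zero] at h
  rw [pComLeibniz_succ, ← hφ x]
  simpa [pCom] using h

lemma vanishesOnNCommutators_of_isCent {R A : Type*} [CommRing R] [Ring A] [Algebra R A]
    {k : ℕ} {γ : A →ₗ[R] A} (hγ : IsLieNDeriv (k + 2) γ) (hc : ∀ x, IsCent (γ x)) :
    VanishesOnNCommutators (k + 2) γ := by
  intro x
  have h : ∀ j, pComLeibniz γ x (j + 1) = 0 := by
    intro j
    induction j with
    | zero =>
      rw [pComLeibniz_succ, pComLeibniz_zero, hc (x 0) (x (0 + 1)), hc (x (0 + 1)) (pCom x 0)]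
      simp
    | succ j ih =>
      rw [pComLeibniz_succ, ih, hc (x (j + 1 + 1)) (pCom x (j + 1))]
      simp
  exact ((isLieNDeriv_succ_iff (k + 1) γ).1 hγ x).trans (h k)

/-- The inner derivation `x ↦ xT - Tx`. -/
def innerDeriv (R : Type*) {A : Type*} [CommRing R] [Ring A] [Algebra R A] (T : A) :
    A →ₗ[R] A :=
  LinearMap.mulRight R T - LinearMap.mulLeft R T

lemma innerDeriv_apply (R : Type*) {A : Type*} [CommRing R] [Ring A] [Algebra R A] (T x : A) :
    innerDeriv R T x = x * T - T * x := rfl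

lemma isDeriv_innerDeriv (R : Type*) {A : Type*} [CommRing R] [Ring A] [Algebra R A] (T : A) :
    IsDeriv (innerDeriv R T) := by
  intro x y
  simp only [innerDeriv_apply]
  noncomm_ring

lemma IsDeriv.add {R A : Type*} [CommRing R] [Ring A] [Algebra R A] {d d' : A →ₗ[R] A}
    (hd : IsDeriv d) (hd' : IsDeriv d') : IsDeriv (d + d') := by
  intro x y
  simp only [LinearMap.add_apply, hd x y, hd' x y]
  noncomm_ring

/-- The sequence `x, y, z, e, e, …`. -/
def tripleSeq {A : Type*} (x y z e : A) : ℕ → A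
  | 0 => x
  | 1 => y
  | 2 => z
  | _ + 3 => e

variable {R A : Type*} [CommRing R] [Ring A] [Algebra R A]

lemma pCom_tripleSeq {x y z : Matrix (Fin 2) (Fin 2) A} {w₁ w₂ : A}
    (hw : (x * y - y * x) * z - z * (x * y - y * x) = !![0, w₁; w₂, 0]) (j : ℕ) :
    pCom (tripleSeq x y z !![1, 0; 0, 0]) (j + 2) = !![0, ((-1 : ℤ) ^ j) • w₁; w₂, 0] := by
  induction j with
  | zero => simpa [pCom, tripleSeq] using hw
  | succ j ih =>
    rw [pCom, ih]
    simp [tripleSeq, pow_succ]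

lemma pComLeibniz_tripleSeq (φ : Matrix (Fin 2) (Fin 2) A → Matrix (Fin 2) (Fin 2) A)
    (hE : IsCent (φ !![1, 0; 0, 0])) (x y z : Matrix (Fin 2) (Fin 2) A) (j : ℕ) :
    pComLeibniz φ (tripleSeq x y z !![1, 0; 0, 0]) (j + 2) 0 1 = ((-1 : ℤ) ^ j) •
        pComLeibniz φ (tripleSeq x y z !![1, 0; 0, 0]) 2 0 1 ∧
      pComLeibniz φ (tripleSeq x y z !![1, 0; 0, 0]) (j + 2) 1 0 =
        pComLeibniz φ (tripleSeq x y z !![1, 0; 0, 0]) 2 1 0 := by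
  induction j with
  | zero => simp
  | succ j ih =>
    have hs : tripleSeq x y z !![1, 0; 0, 0] (j + 2 + 1) = !![1, 0; 0, 0] := rfl
    rw [show j + 1 + 2 = j + 2 + 1 by ring, pComLeibniz_succ, hs, hE, sub_self, add_zero]
    constructor
    · simp [Matrix.mul_apply, vecMul, dotProduct, Fin.sum_univ_two, ih.1, pow_succ]
    · simp [Matrix.mul_apply, vecMul, dotProduct, Fin.sum_univ_two, ih.2]

lemma pComLeibniz_tripleSeq_two (φ : Matrix (Fin 2) (Fin 2) A → Matrix (Fin 2) (Fin 2) A)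
    (x y z e : Matrix (Fin 2) (Fin 2) A) :
    pComLeibniz φ (tripleSeq x y z e) 2 =
      ((φ x * y - y * φ x + (x * φ y - φ y * x)) * z -
        z * (φ x * y - y * φ x + (x * φ y - φ y * x))) +
        ((x * y - y * x) * φ z - φ z * (x * y - y * x)) := by
  simp only [pComLeibniz_succ, pComLeibniz_zero]
  rfl

lemma isCent_of_scalar {c : A} (hc : ∀ a, a * c = c * a) :
    IsCent (!![c, 0; 0, c] : Matrix (Fin 2) (Fin 2) A) := by
  intro y
  ext i j
  fin_cases i <;> fin_cases j <;> simp [Matrix.mul_apply, Fin.sum_univ_two, hc]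

lemma sum_eq_of_fin_two (x : Matrix (Fin 2) (Fin 2) A) :
    x = !![x 0 0, 0; 0, 0] + !![0, x 0 1; 0, 0] + !![0, 0; x 1 0, 0] + !![0, 0; 0, x 1 1] := by
  ext i j
  fin_cases i <;> fin_cases j <;> simp

lemma pCom_const_tail (a : A) (j : ℕ) :
    pCom (tripleSeq !![0, a; 0, 0] !![1, 0; 0, 0] !![1, 0; 0, 0] !![1, 0; 0, 0]) j =
      !![0, ((-1 : ℤ) ^ j) • a; 0, 0] := by
  induction j with
  | zero => simp [pCom, tripleSeq]
  | succ j ih =>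
    have hs : tripleSeq (!![0, a; 0, 0] : Matrix (Fin 2) (Fin 2) A) !![1, 0; 0, 0] !![1, 0; 0, 0]
        !![1, 0; 0, 0] (j + 1) = !![1, 0; 0, 0] := by
      rcases j with _ | _ | j <;> rfl
    rw [pCom, ih, hs]
    ext i j
    fin_cases i <;> fin_cases j <;> simp [pow_succ]

lemma pComLeibniz_const_tail (φ : Matrix (Fin 2) (Fin 2) A → Matrix (Fin 2) (Fin 2) A)
    (h01 : φ !![1, 0; 0, 0] 0 1 = 0) (h10 : φ !![1, 0; 0, 0] 1 0 = 0) (a : A) (j : ℕ) :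
    pComLeibniz φ
        (tripleSeq !![0, a; 0, 0] !![1, 0; 0, 0] !![1, 0; 0, 0] !![1, 0; 0, 0]) (j + 1) =
      !![0, ((-1 : ℤ) ^ (j + 1)) • (φ !![0, a; 0, 0] 0 1 -
          (j + 1) • (a * φ !![1, 0; 0, 0] 1 1 - φ !![1, 0; 0, 0] 0 0 * a));
        φ !![0, a; 0, 0] 1 0, 0] := by
  have hs : ∀ j, tripleSeq (!![0, a; 0, 0] : Matrix (Fin 2) (Fin 2) A) !![1, 0; 0, 0]
      !![1, 0; 0, 0] !![1, 0; 0, 0] (j + 1) = !![1, 0; 0, 0] := by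
    intro j
    rcases j with _ | _ | j <;> rfl
  induction j with
  | zero =>
    rw [pComLeibniz_succ, pComLeibniz_zero, pCom_const_tail, hs]
    ext i j
    fin_cases i <;> fin_cases j <;>
      simp [Matrix.mul_apply, vecMul, dotProduct, Fin.sum_univ_two, h01, h10, tripleSeq]
    abel
  | succ j ih =>
    rw [pComLeibniz_succ, ih, pCom_const_tail, hs]
    ext i j'
    fin_cases i <;> fin_cases j' <;>
      simp [Matrix.mul_apply, vecMul, dotProduct, Fin.sum_univ_two, h01, h10,
        pow_succ (-1 : ℤ) (j + 1)]
    rcases neg_one_pow_eq_or A (j + 1) with h | h <;> simp [h] <;> noncomm_ring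

lemma eq_zero_of_eq_neg_self (h2 : TorsionFreeAt A 2) {x : A} (h : x = -x) : x = 0 := by
  apply h2
  rw [two_nsmul]
  nth_rewrite 2 [h]
  exact add_neg_cancel x

lemma IsLieNDeriv.apply_offDiag {k : ℕ}
    {φ : Matrix (Fin 2) (Fin 2) A →ₗ[R] Matrix (Fin 2) (Fin 2) A}
    (hφ : IsLieNDeriv (k + 3) φ) (hE : IsCent (φ !![1, 0; 0, 0]))
    {x y z : Matrix (Fin 2) (Fin 2) A} {w₁ w₂ : A}
    (hw : (x * y - y * x) * z - z * (x * y - y * x) = !![0, w₁; w₂, 0]) :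
    φ !![0, ((-1 : ℤ) ^ k) • w₁; w₂, 0] 0 1 = ((-1 : ℤ) ^ k) •
        (((φ x * y - y * φ x + (x * φ y - φ y * x)) * z -
          z * (φ x * y - y * φ x + (x * φ y - φ y * x))) +
          ((x * y - y * x) * φ z - φ z * (x * y - y * x))) 0 1 ∧
      φ !![0, ((-1 : ℤ) ^ k) • w₁; w₂, 0] 1 0 =
        (((φ x * y - y * φ x + (x * φ y - φ y * x)) * z -
          z * (φ x * y - y * φ x + (x * φ y - φ y * x))) +
          ((x * y - y * x) * φ z - φ z * (x * y - y * x))) 1 0 := by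
  have h := (isLieNDeriv_succ_iff (k + 2) φ).1 hφ (tripleSeq x y z !![1, 0; 0, 0])
  have h' := pComLeibniz_tripleSeq φ hE x y z k
  rw [pCom_tripleSeq hw] at h
  rw [← h, pComLeibniz_tripleSeq_two] at h'
  exact h'

/-- The sign in `IsLieNDeriv.apply_offDiag` disappears when `w₂ = 0`. -/
lemma IsLieNDeriv.apply_upper {k : ℕ}
    {φ : Matrix (Fin 2) (Fin 2) A →ₗ[R] Matrix (Fin 2) (Fin 2) A}
    (hφ : IsLieNDeriv (k + 3) φ) (hE : IsCent (φ !![1, 0; 0, 0]))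
    {x y z : Matrix (Fin 2) (Fin 2) A} {w : A}
    (hw : (x * y - y * x) * z - z * (x * y - y * x) = !![0, w; 0, 0]) :
    φ !![0, w; 0, 0] 0 1 =
        (((φ x * y - y * φ x + (x * φ y - φ y * x)) * z -
          z * (φ x * y - y * φ x + (x * φ y - φ y * x))) +
          ((x * y - y * x) * φ z - φ z * (x * y - y * x))) 0 1 ∧
      ((-1 : ℤ) ^ k) • φ !![0, w; 0, 0] 1 0 =
        (((φ x * y - y * φ x + (x * φ y - φ y * x)) * z -
          z * (φ x * y - y * φ x + (x * φ y - φ y * x))) +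
          ((x * y - y * x) * φ z - φ z * (x * y - y * x))) 1 0 := by
  have h := hφ.apply_offDiag hE hw
  have hs : (!![0, ((-1 : ℤ) ^ k) • w; 0, 0] : Matrix (Fin 2) (Fin 2) A) =
      ((-1 : ℤ) ^ k) • !![0, w; 0, 0] := by
    ext i j
    fin_cases i <;> fin_cases j <;> simp
  rw [hs, map_zsmul, Matrix.smul_apply, Matrix.smul_apply] at h
  refine ⟨?_, h.2⟩
  rcases neg_one_pow_eq_or ℤ k with hk | hk
  · simpa only [hk, one_smul] using h.1
  · simpa only [hk, neg_smul, one_smul, neg_inj] using h.1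

lemma isCent_apply_idempotent {k : ℕ} (hN : TorsionFreeAt A (k + 2))
    {φ : Matrix (Fin 2) (Fin 2) A →ₗ[R] Matrix (Fin 2) (Fin 2) A}
    (hφ : IsLieNDeriv (k + 3) φ)
    (h01 : φ !![1, 0; 0, 0] 0 1 = 0) (h10 : φ !![1, 0; 0, 0] 1 0 = 0) :
    IsCent (φ !![1, 0; 0, 0]) := by
  have key : ∀ a, φ !![0, ((-1 : ℤ) ^ (k + 2)) • a; 0, 0] =
      !![0, ((-1 : ℤ) ^ (k + 2)) • (φ !![0, a; 0, 0] 0 1 -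
          (k + 2) • (a * φ !![1, 0; 0, 0] 1 1 - φ !![1, 0; 0, 0] 0 0 * a));
        φ !![0, a; 0, 0] 1 0, 0] := by
    intro a
    rw [← pCom_const_tail a, (isLieNDeriv_succ_iff (k + 2) φ).1 hφ]
    exact pComLeibniz_const_tail φ h01 h10 a (k + 1)
  have hs : ∀ a : A, (!![0, ((-1 : ℤ) ^ (k + 2)) • a; 0, 0] : Matrix (Fin 2) (Fin 2) A) =
      ((-1 : ℤ) ^ (k + 2)) • !![0, a; 0, 0] := by
    intro a
    ext i j
    fin_cases i <;> fin_cases j <;> simp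
  simp only [hs, map_zsmul] at key
  have hinj : ∀ a b : A, ((-1 : ℤ) ^ (k + 2)) • a = ((-1 : ℤ) ^ (k + 2)) • b → a = b := by
    intro a b h
    rcases neg_one_pow_eq_or ℤ (k + 2) with hk | hk
    · simpa only [hk, one_smul] using h
    · simpa only [hk, neg_smul, one_smul, neg_inj] using h
  have hc : ∀ a, a * φ !![1, 0; 0, 0] 1 1 = φ !![1, 0; 0, 0] 0 0 * a := by
    intro a
    have h := congrFun (congrFun (key a) 0) 1
    rw [Matrix.smul_apply] at h
    have h' := hinj _ _ h
    exact sub_eq_zero.1 (hN _ (sub_eq_self.1 h'.symm))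
  have h1 : φ !![1, 0; 0, 0] 1 1 = φ !![1, 0; 0, 0] 0 0 := by simpa using hc 1
  have hd : φ !![1, 0; 0, 0] = !![φ !![1, 0; 0, 0] 0 0, 0; 0, φ !![1, 0; 0, 0] 0 0] := by
    ext i j
    fin_cases i <;> fin_cases j <;> simp [h01, h10, h1]
  rw [hd]
  exact isCent_of_scalar fun a => by rw [← hc a, h1]

lemma IsLieNDeriv.apply_lower {k : ℕ}
    {φ : Matrix (Fin 2) (Fin 2) A →ₗ[R] Matrix (Fin 2) (Fin 2) A}
    (hφ : IsLieNDeriv (k + 3) φ) (hE : IsCent (φ !![1, 0; 0, 0]))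
    {x y z : Matrix (Fin 2) (Fin 2) A} {w : A}
    (hw : (x * y - y * x) * z - z * (x * y - y * x) = !![0, 0; w, 0]) :
    φ !![0, 0; w, 0] 0 1 = ((-1 : ℤ) ^ k) •
        (((φ x * y - y * φ x + (x * φ y - φ y * x)) * z -
          z * (φ x * y - y * φ x + (x * φ y - φ y * x))) +
          ((x * y - y * x) * φ z - φ z * (x * y - y * x))) 0 1 ∧
      φ !![0, 0; w, 0] 1 0 =
        (((φ x * y - y * φ x + (x * φ y - φ y * x)) * z -
          z * (φ x * y - y * φ x + (x * φ y - φ y * x))) +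
          ((x * y - y * x) * φ z - φ z * (x * y - y * x))) 1 0 := by
  have h := hφ.apply_offDiag hE hw
  rwa [smul_zero] at h

lemma IsLieNDeriv.apply_offDiag_diag {k : ℕ}
    {φ : Matrix (Fin 2) (Fin 2) A →ₗ[R] Matrix (Fin 2) (Fin 2) A}
    (hφ : IsLieNDeriv (k + 3) φ) (hE : IsCent (φ !![1, 0; 0, 0])) (a b : A) :
    φ !![0, a; b, 0] 0 0 = 0 ∧ φ !![0, a; b, 0] 1 1 = 0 := by
  have hw : pCom (tripleSeq !![0, ((-1 : ℤ) ^ k) • a; b, 0] !![1, 0; 0, 0] !![1, 0; 0, 0]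
      !![1, 0; 0, 0]) (k + 2) = !![0, a; b, 0] := by
    rw [pCom_tripleSeq (w₁ := ((-1 : ℤ) ^ k) • a) (w₂ := b) (by simp), smul_smul, ← mul_pow]
    simp
  have hs : tripleSeq (!![0, ((-1 : ℤ) ^ k) • a; b, 0] : Matrix (Fin 2) (Fin 2) A) !![1, 0; 0, 0]
      !![1, 0; 0, 0] !![1, 0; 0, 0] (k + 1 + 1) = !![1, 0; 0, 0] := by
    cases k <;> rfl
  rw [← hw, (isLieNDeriv_succ_iff (k + 2) φ).1 hφ, pComLeibniz_succ, hs, hE, sub_self, add_zero]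
  constructor <;> simp [Matrix.mul_apply, vecMul, dotProduct, Fin.sum_univ_two]

lemma IsLieNDeriv.apply_diag {k : ℕ}
    {φ : Matrix (Fin 2) (Fin 2) A →ₗ[R] Matrix (Fin 2) (Fin 2) A}
    (hφ : IsLieNDeriv (k + 3) φ) (hE : IsCent (φ !![1, 0; 0, 0])) (x y : A) :
    φ !![x, 0; 0, y] = !![φ !![x, 0; 0, y] 0 0, 0; 0, φ !![x, 0; 0, y] 1 1] := by
  have h := hφ.apply_upper hE (x := !![x, 0; 0, y]) (y := !![1, 0; 0, 0]) (z := !![1, 0; 0, 0])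
    (w := 0) (by
      ext i j
      fin_cases i <;> fin_cases j <;> simp)
  have h0 : (!![0, 0; 0, 0] : Matrix (Fin 2) (Fin 2) A) = 0 := by
    ext i j
    fin_cases i <;> fin_cases j <;> rfl
  rw [h0, map_zero, hE, hE] at h
  simp [Matrix.mul_apply, vecMul, dotProduct, Fin.sum_univ_two] at h
  ext i j
  fin_cases i <;> fin_cases j <;> simp [← h.1, ← h.2]

lemma eq_zero_of_add_self_eq_neg (h2 : TorsionFreeAt A 2) {x : A} (h : x + x = -(x + x)) :
    x = 0 := by
  apply h2
  rw [two_nsmul]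
  exact eq_zero_of_eq_neg_self h2 h

lemma IsLieNDeriv.apply_strictUpper {k : ℕ} (h2 : TorsionFreeAt A 2)
    {φ : Matrix (Fin 2) (Fin 2) A →ₗ[R] Matrix (Fin 2) (Fin 2) A}
    (hφ : IsLieNDeriv (k + 3) φ) (hE : IsCent (φ !![1, 0; 0, 0])) (a : A) :
    φ !![0, a; 0, 0] = !![0, φ !![0, a; 0, 0] 0 1; 0, 0] := by
  have hs := (hφ.apply_upper hE (x := !![0, a; 0, 0]) (y := !![1, 0; 0, 0])
      (z := !![1, 0; 0, 0]) (w := a) (by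
        ext i j
        fin_cases i <;> fin_cases j <;> simp)).2
  rw [hE, hE] at hs
  simp [Matrix.mul_apply, vecMul, dotProduct, Fin.sum_univ_two] at hs
  have hd := (hφ.apply_upper hE (x := !![0, 1; 0, 0]) (y := !![0, 0; 1, 0])
    (z := !![0, a; 0, 0]) (w := a + a) (by
      ext i j
      fin_cases i <;> fin_cases j <;> simp)).2
  have h2a : (!![0, a + a; 0, 0] : Matrix (Fin 2) (Fin 2) A) =
      !![0, a; 0, 0] + !![0, a; 0, 0] := by
    ext i j
    fin_cases i <;> fin_cases j <;> simp
  rw [h2a, map_add, Matrix.add_apply] at hd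
  simp [mul_add, hs, Matrix.mul_apply, vecMul, dotProduct, Fin.sum_univ_two] at hd
  have h10 : φ !![0, a; 0, 0] 1 0 = 0 :=
    eq_zero_of_add_self_eq_neg h2 (hd.trans (by abel))
  have hdiag := hφ.apply_offDiag_diag hE a 0
  ext i j
  fin_cases i <;> fin_cases j <;> simp [hdiag, h10]

lemma IsLieNDeriv.apply_strictLower {k : ℕ} (h2 : TorsionFreeAt A 2)
    {φ : Matrix (Fin 2) (Fin 2) A →ₗ[R] Matrix (Fin 2) (Fin 2) A}
    (hφ : IsLieNDeriv (k + 3) φ) (hE : IsCent (φ !![1, 0; 0, 0])) (b : A) :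
    φ !![0, 0; b, 0] = !![0, 0; φ !![0, 0; b, 0] 1 0, 0] := by
  have hs := (hφ.apply_lower hE (x := !![0, 0; b, 0]) (y := !![1, 0; 0, 0])
      (z := !![1, 0; 0, 0]) (w := b) (by simp)).1
  rw [hE, hE] at hs
  simp [Matrix.mul_apply, vecMul, dotProduct, Fin.sum_univ_two] at hs
  have hd := (hφ.apply_lower hE (x := !![0, 0; 1, 0]) (y := !![0, 1; 0, 0])
    (z := !![0, 0; b, 0]) (w := b + b) (by
      ext i j
      fin_cases i <;> fin_cases j <;> simp)).1
  have h2b : (!![0, 0; b + b, 0] : Matrix (Fin 2) (Fin 2) A) =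
      !![0, 0; b, 0] + !![0, 0; b, 0] := by
    ext i j
    fin_cases i <;> fin_cases j <;> simp
  rw [h2b, map_add, Matrix.add_apply] at hd
  simp [Matrix.mul_apply, vecMul, dotProduct, Fin.sum_univ_two] at hd
  have h01 : φ !![0, 0; b, 0] 0 1 = 0 := by
    rcases neg_one_pow_eq_or A k with hk | hk
    · rw [hk, one_mul] at hd
      exact eq_zero_of_add_self_eq_neg h2 (hd.trans (by abel))
    · rw [hk, neg_one_mul] at hs
      exact eq_zero_of_eq_neg_self h2 hs
  have hdiag := hφ.apply_offDiag_diag hE 0 b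
  ext i j
  fin_cases i <;> fin_cases j <;> simp [hdiag, h01]

lemma comm_of_commutators_comm
    (hA : (∀ x y : A, x * y = y * x) ∨
      ∀ a b : A, (∀ x : A, a * x * b = 0) → a = 0 ∨ b = 0)
    {w : A} (hw : ∀ x y : A, (x * w - w * x) * y = y * (x * w - w * x)) (x : A) :
    x * w = w * x := by
  rcases hA with hA | hA
  · exact hA x w
  · have h := hw (w * x) x
    have hv : (x * w - w * x) * (x * w - w * x) = 0 := by
      have h1 : w * x * w - w * (w * x) = w * (x * w - w * x) := by noncomm_ring
      rw [h1, ← hw x w] at h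
      have h2 := hw x x
      have h3 : (x * w - w * x) * (x * w - w * x) =
          x * ((x * w - w * x) * w) - (x * w - w * x) * w * x := by
        rw [← mul_assoc x, ← h2]
        noncomm_ring
      rw [h3, h, sub_self]
    refine sub_eq_zero.1 ((or_self_iff).1 (hA _ _ fun z => ?_))
    rw [hw x z, mul_assoc, hv, mul_zero]

lemma comm_of_leibniz_defect
    (hA : (∀ x y : A, x * y = y * x) ∨
      ∀ a b : A, (∀ x : A, a * x * b = 0) → a = 0 ∨ b = 0)
    {f q : A → A}
    (h1 : ∀ x y, f (x * y) = f x * y + x * f y + (q x * y - y * q x))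
    (h2 : ∀ x y, f (x * y) = f x * y + x * f y + (x * q y - q y * x)) (x z : A) :
    x * q z = q z * x := by
  refine comm_of_commutators_comm hA (fun x y => ?_) x
  have e1 := h2 (x * y) z
  have e2 := h1 x (y * z)
  rw [h1 x y] at e1
  rw [h2 y z, ← mul_assoc x y z, e1] at e2
  have e3 := h1 x z
  rw [h2 x z, add_right_inj] at e3
  have e4 : (x * q z - q z * x) * y - y * (q x * z - z * q x) =
      (f x * y + x * f y + (q x * y - y * q x)) * z + x * y * f z +
          (x * y * q z - q z * (x * y)) -
        (f x * (y * z) + x * (f y * z + y * f z + (y * q z - q z * y)) +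
          (q x * (y * z) - y * z * q x)) := by
    noncomm_ring
  rw [e2, sub_self, ← e3] at e4
  exact sub_eq_zero.1 e4

/-- The `R`-linear map `a ↦ φ(aE₁₂)₁₂`. -/
def upperEntry (φ : Matrix (Fin 2) (Fin 2) A →ₗ[R] Matrix (Fin 2) (Fin 2) A) : A →ₗ[R] A :=
  Matrix.entryLinearMap R A 0 1 ∘ₗ φ ∘ₗ Matrix.singleLinearMap R 0 1

lemma single_zero_one (a : A) :
    Matrix.single 0 1 a = (!![0, a; 0, 0] : Matrix (Fin 2) (Fin 2) A) := by
  ext i j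
  fin_cases i <;> fin_cases j <;> simp

lemma upperEntry_apply (φ : Matrix (Fin 2) (Fin 2) A →ₗ[R] Matrix (Fin 2) (Fin 2) A) (a : A) :
    upperEntry φ a = φ !![0, a; 0, 0] 0 1 := by
  rw [← single_zero_one]
  rfl

lemma IsDeriv.mapMatrix {f : A →ₗ[R] A} (hf : IsDeriv f) :
    IsDeriv (f.mapMatrix : Matrix (Fin 2) (Fin 2) A →ₗ[R] Matrix (Fin 2) (Fin 2) A) := by
  intro x y
  ext i j
  simp only [LinearMap.mapMatrix_apply, Matrix.map_apply, Matrix.add_apply, Matrix.mul_apply,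
    Fin.sum_univ_two, map_add, hf (x i _) (y _ j)]
  abel

lemma exists_isDeriv_isCent_of_normalized {k : ℕ} (h2 : TorsionFreeAt A 2)
    (hN : TorsionFreeAt A (k + 2))
    (hA : (∀ x y : A, x * y = y * x) ∨
      ∀ a b : A, (∀ x : A, a * x * b = 0) → a = 0 ∨ b = 0)
    {φ : Matrix (Fin 2) (Fin 2) A →ₗ[R] Matrix (Fin 2) (Fin 2) A}
    (hφ : IsLieNDeriv (k + 3) φ)
    (h01 : φ !![1, 0; 0, 0] 0 1 = 0) (h10 : φ !![1, 0; 0, 0] 1 0 = 0)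
    (hf1 : φ !![0, 1; 0, 0] 0 1 = 0) :
    ∃ d : Matrix (Fin 2) (Fin 2) A →ₗ[R] Matrix (Fin 2) (Fin 2) A,
      IsDeriv d ∧ ∀ x, IsCent ((φ - d) x) := by
  have hE := isCent_apply_idempotent hN hφ h01 h10
  have hU : ∀ a, φ !![0, a; 0, 0] = !![0, upperEntry φ a; 0, 0] := fun a => by
    rw [upperEntry_apply]
    exact hφ.apply_strictUpper h2 hE a
  have hL := hφ.apply_strictLower h2 hE
  have hD := hφ.apply_diag hE
  set f := upperEntry φ
  obtain ⟨g, hg⟩ : ∃ g : A → A, ∀ b, g b = φ !![0, 0; b, 0] 1 0 := ⟨_, fun _ => rfl⟩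
  obtain ⟨p, hp⟩ : ∃ p : A → A → A, ∀ x y, p x y = φ !![x, 0; 0, y] 0 0 := ⟨_, fun _ _ => rfl⟩
  obtain ⟨s, hs⟩ : ∃ s : A → A → A, ∀ x y, s x y = φ !![x, 0; 0, y] 1 1 := ⟨_, fun _ _ => rfl⟩
  simp only [← hg] at hL
  simp only [← hp, ← hs] at hD
  have hf1 : f 1 = 0 := by rwa [hU] at hf1
  have hupper : ∀ x y a, f (a * y - x * a) = a * s x y - p x y * a + f a * y - x * f a := by
    intro x y a
    have h := (hφ.apply_upper hE (x := !![x, 0; 0, y]) (y := !![0, a; 0, 0])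
      (z := !![1, 0; 0, 0]) (w := a * y - x * a) (by
        ext i j
        fin_cases i <;> fin_cases j <;> simp)).1
    rw [hE, hD, hU, hU] at h
    simp at h
    rw [map_sub, h]
    abel
  have hlower : ∀ x y b, g (y * b - b * x) = s x y * b - b * p x y + y * g b - g b * x := by
    intro x y b
    have h := (hφ.apply_lower hE (x := !![x, 0; 0, y]) (y := !![0, 0; b, 0])
      (z := !![1, 0; 0, 0]) (w := y * b - b * x) (by
        ext i j
        fin_cases i <;> fin_cases j <;> simp)).2
    rw [hE, hD, hL, hL] at h
    simp at h
    rw [h]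
    abel
  have hg1 : g 1 = 0 := by
    have h := (hφ.apply_upper hE (x := !![0, 1; 0, 0]) (y := !![0, 0; 1, 0])
      (z := !![0, 1; 0, 0]) (w := 1 + 1) (by
        ext i j
        fin_cases i <;> fin_cases j <;> simp)).1
    rw [hU, hU, hL] at h
    simp [hf1] at h
    apply h2
    rw [two_nsmul, ← h]
  have hfp : ∀ x, p x 0 = f x + s x 0 := fun x => by
    have h := hupper x 0 1
    simp [hf1] at h
    rw [← neg_neg (f x), h]
    abel
  have hfs : ∀ y, s 0 y = f y + p 0 y := fun y => by
    have h := hupper 0 y 1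
    simp [hf1] at h
    rw [h]
    abel
  have hgf : ∀ y, g y = f y := fun y => by
    have h := hlower 0 y 1
    simp [hg1] at h
    rw [h, hfs]
    abel
  have hx₁ : ∀ x a, f (x * a) = f x * a + x * f a + (s x 0 * a - a * s x 0) := fun x a => by
    have h := hupper x 0 a
    rw [mul_zero, zero_sub, map_neg, hfp] at h
    rw [← neg_inj, h]
    noncomm_ring
  have hx₂ : ∀ b x, f (b * x) = f b * x + b * f x + (b * s x 0 - s x 0 * b) := fun b x => by
    have h := hlower x 0 b
    rw [zero_mul, zero_sub, hgf, hgf, map_neg, hfp] at h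
    rw [← neg_inj, h]
    noncomm_ring
  have hy₁ : ∀ y b, f (y * b) = f y * b + y * f b + (p 0 y * b - b * p 0 y) := fun y b => by
    have h := hlower 0 y b
    rw [mul_zero, sub_zero, hgf, hgf, hfs] at h
    rw [h]
    noncomm_ring
  have hy₂ : ∀ a y, f (a * y) = f a * y + a * f y + (a * p 0 y - p 0 y * a) := fun a y => by
    have h := hupper 0 y a
    rw [zero_mul, sub_zero, hfs] at h
    rw [h]
    noncomm_ring
  have hsc : ∀ x z, x * s z 0 = s z 0 * x := comm_of_leibniz_defect (q := fun x => s x 0) hA hx₁ hx₂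
  have hpc : ∀ x z, x * p 0 z = p 0 z * x := comm_of_leibniz_defect (q := p 0) hA hy₁ hy₂
  have hf : IsDeriv f := fun x y => by rw [hx₂, hsc, sub_self, add_zero]
  refine ⟨f.mapMatrix, hf.mapMatrix, fun x => ?_⟩
  have hx : φ x - f.mapMatrix x =
      !![s (x 0 0) 0 + p 0 (x 1 1), 0; 0, s (x 0 0) 0 + p 0 (x 1 1)] := by
    have h : φ x = _ := congrArg φ (sum_eq_of_fin_two x)
    rw [map_add, map_add, map_add, hD, hD, hU, hL, hgf, hfp, hfs] at h
    rw [h]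
    ext i j
    fin_cases i <;> fin_cases j <;> simp <;> abel
  rw [LinearMap.sub_apply, hx]
  exact isCent_of_scalar fun a => by rw [mul_add, add_mul, hsc, hpc]

lemma exists_isDeriv_isCent {k : ℕ} (h2 : TorsionFreeAt A 2) (hN : TorsionFreeAt A (k + 2))
    (hA : (∀ x y : A, x * y = y * x) ∨
      ∀ a b : A, (∀ x : A, a * x * b = 0) → a = 0 ∨ b = 0)
    {φ : Matrix (Fin 2) (Fin 2) A →ₗ[R] Matrix (Fin 2) (Fin 2) A}
    (hφ : IsLieNDeriv (k + 3) φ) :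
    ∃ d : Matrix (Fin 2) (Fin 2) A →ₗ[R] Matrix (Fin 2) (Fin 2) A,
      IsDeriv d ∧ ∀ x, IsCent ((φ - d) x) := by
  obtain ⟨T, hT⟩ : ∃ T : Matrix (Fin 2) (Fin 2) A, T = !![-φ !![0, 1; 0, 0] 0 1,
    φ !![1, 0; 0, 0] 0 1; -φ !![1, 0; 0, 0] 1 0, 0] := ⟨_, rfl⟩
  have hi := isDeriv_innerDeriv R T
  obtain ⟨d, hd, hc⟩ := exists_isDeriv_isCent_of_normalized h2 hN hA
    (hφ.sub (hi.isLieNDeriv (k + 2)))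
    (by simp [innerDeriv_apply, hT]) (by simp [innerDeriv_apply, hT])
    (by simp [innerDeriv_apply, hT])
  refine ⟨innerDeriv R T + d, hi.add hd, fun x => ?_⟩
  rw [← sub_sub]
  exact hc x

end LieNDerivations

theorem stmt_15 (R : Type*) [CommRing R] (A : Type*) [Ring A] [Algebra R A]
    (n : ℕ) (hn : 2 ≤ n)
    (h2 : TorsionFreeAt A 2) (hn1 : TorsionFreeAt A (n - 1))
    (hA : (∀ x y : A, x * y = y * x) ∨
      ((¬ ∀ x y : A, x * y = y * x) ∧
        ∀ a b : A, (∀ x : A, a * x * b = 0) → a = 0 ∨ b = 0))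
    (φ : Matrix (Fin 2) (Fin 2) A →ₗ[R] Matrix (Fin 2) (Fin 2) A)
    (hφ : IsLieNDeriv n φ) :
    IsStandardLieNDeriv n φ := by
  have hA' : (∀ x y : A, x * y = y * x) ∨
      ∀ a b : A, (∀ x : A, a * x * b = 0) → a = 0 ∨ b = 0 := hA.imp_right And.right
  obtain ⟨m, rfl⟩ : ∃ m, n = m + 2 := ⟨n - 2, by omega⟩
  obtain ⟨d, hd, hc⟩ : ∃ d : Matrix (Fin 2) (Fin 2) A →ₗ[R] Matrix (Fin 2) (Fin 2) A,
      IsDeriv d ∧ ∀ x, IsCent ((φ - d) x) := by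
    rcases m with _ | k
    · exact exists_isDeriv_isCent (k := 0) h2 h2 hA' hφ.three_of_two
    · exact exists_isDeriv_isCent h2 hn1 hA' hφ
  exact ⟨d, φ - d, hd, hc, vanishesOnNCommutators_of_isCent (hφ.sub (hd.isLieNDeriv (m + 1))) hc,
    (add_sub_cancel d φ).symm⟩
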